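/- Let s ≥ 1, let w ∈ ℝ^s with ‖w‖ = 1 and ξ ∈ ℝ with |ξ| ≤ 1, and let M(ξ, w) := (1/2) [[1, wᵀ], [w, (1+ξ) I_s − ξ w wᵀ]] ∈ ℝ^{(s+1)×(s+1)}. Then M(ξ, w) is positive semidefinite and I_{s+1} − M(ξ, w) is positive semidefinite; equivalently, every eigenvalue of M(ξ, w) lies in the interval [0, 1]. -/

import Mathlib

open Matrix

noncomputable section

/-- `ℝⁿ` with the Euclidean norm. -/
abbrev Vec (n : ℕ) : Type := EuclideanSpace ℝ (Fin n)

/-- The matrix `M(ξ, w) = (1/2) [[1, wᵀ], [w, (1+ξ)I − ξ w wᵀ]]`. -/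
def Mmat {s : ℕ} (ξ : ℝ) (w : Fin s → ℝ) : Matrix (Fin (s+1)) (Fin (s+1)) ℝ :=
  Matrix.of fun i j =>
    if hi : i = 0 then (if hj : j = 0 then 1/2 else w (j.pred hj) / 2)
    else if hj : j = 0 then w (i.pred hi) / 2
    else (1/2) * ((1+ξ) * (if i = j then 1 else 0) - ξ * w (i.pred hi) * w (j.pred hj))

/-- `Γ = diag(1, -I)`. -/
def GammaMat (s : ℕ) : Matrix (Fin (s+1)) (Fin (s+1)) ℝ :=
  Matrix.diagonal (fun j => if j = 0 then 1 else -1)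

/-- The quadratic form of `M(ξ, w)`, split along the first coordinate. -/
theorem dotProduct_Mmat_mulVec {s : ℕ} (ξ : ℝ) (w : Fin s → ℝ) (u : Fin (s+1) → ℝ) :
    u ⬝ᵥ Mmat ξ w *ᵥ u =
      (1/2) * ((u 0 + ∑ i, w i * u i.succ) ^ 2 +
        (1 + ξ) * (∑ i : Fin s, u i.succ ^ 2 - (∑ i, w i * u i.succ) ^ 2)) := by
  have hzero : (Mmat ξ w *ᵥ u) 0 = (1/2) * (u 0 + ∑ i, w i * u i.succ) := by
    simp only [Matrix.mulVec, dotProduct, Mmat, Matrix.of_apply, Fin.sum_univ_succ,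
      Fin.succ_ne_zero, dite_true, dite_false, Fin.pred_succ]
    rw [mul_add, Finset.mul_sum]
    congr 1
    exact Finset.sum_congr rfl fun j _ => by ring
  have hsucc (i : Fin s) : (Mmat ξ w *ᵥ u) i.succ =
      (1/2) * (w i * u 0 + (1 + ξ) * u i.succ - ξ * w i * ∑ j, w j * u j.succ) := by
    simp only [Matrix.mulVec, dotProduct, Mmat, Matrix.of_apply, Fin.sum_univ_succ,
      Fin.succ_ne_zero, dite_true, dite_false, Fin.pred_succ, Fin.succ_inj]
    have hterm (j : Fin s) :
        (1/2) * ((1 + ξ) * (if i = j then 1 else 0) - ξ * w i * w j) * u j.succ =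
          (if i = j then (1/2) * (1 + ξ) * u j.succ else 0) -
            (1/2) * ξ * w i * (w j * u j.succ) := by
      split_ifs <;> ring
    simp only [hterm, Finset.sum_sub_distrib, Finset.sum_ite_eq, Finset.mem_univ, if_true,
      ← Finset.mul_sum]
    ring
  rw [dotProduct, Fin.sum_univ_succ, hzero]
  simp only [hsucc]
  generalize hp : ∑ i, w i * u i.succ = p
  have hsum : ∑ i : Fin s, u i.succ * ((1/2) * (w i * u 0 + (1 + ξ) * u i.succ - ξ * w i * p)) =
      (1/2) * (u 0 - ξ * p) * p + (1/2) * (1 + ξ) * ∑ i : Fin s, u i.succ ^ 2 := by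
    conv_rhs => enter [1, 2]; rw [← hp]
    rw [Finset.mul_sum, Finset.mul_sum, ← Finset.sum_add_distrib]
    exact Finset.sum_congr rfl fun i _ => by ring
  rw [hsum]
  ring

/-- Lemma 2.5 of the paper. For `‖w‖ = 1` (Euclidean norm) and
`|ξ| ≤ 1`, the matrix `M(ξ, w)` satisfies `0 ⪯ M(ξ, w) ⪯ I`, i.e. both `M(ξ, w)`
and `I − M(ξ, w)` are positive semidefinite (equivalently, all eigenvalues of
`M(ξ, w)` lie in `[0, 1]`). -/
theorem stmt_7 {s : ℕ} (hs : 1 ≤ s) (w : Vec s) (hw : ‖w‖ = 1)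
    (ξ : ℝ) (hξ : |ξ| ≤ 1) :
    (∀ u : Fin (s+1) → ℝ, 0 ≤ u ⬝ᵥ Mmat ξ (fun j => w j) *ᵥ u) ∧
    (∀ u : Fin (s+1) → ℝ, 0 ≤ u ⬝ᵥ ((1 : Matrix (Fin (s+1)) (Fin (s+1)) ℝ)
        - Mmat ξ (fun j => w j)) *ᵥ u) := by
  have hw' : ∑ i, w i ^ 2 = 1 := by
    rw [← EuclideanSpace.real_norm_sq_eq, hw, one_pow]
  have hcs (u : Fin (s+1) → ℝ) :
      0 ≤ ∑ i : Fin s, u i.succ ^ 2 - (∑ i, w i * u i.succ) ^ 2 := by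
    have h := Finset.sum_mul_sq_le_sq_mul_sq Finset.univ (fun i => w i) fun i => u i.succ
    rw [hw', one_mul] at h
    exact sub_nonneg.2 h
  obtain ⟨hlow, hupp⟩ := abs_le.1 hξ
  refine ⟨fun u => ?_, fun u => ?_⟩
  · rw [dotProduct_Mmat_mulVec]
    nlinarith [sq_nonneg (u 0 + ∑ i, w i * u i.succ),
      mul_nonneg (by linarith : 0 ≤ 1 + ξ) (hcs u)]
  · rw [Matrix.sub_mulVec, dotProduct_sub, Matrix.one_mulVec, dotProduct_Mmat_mulVec,
      dotProduct, Fin.sum_univ_succ]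
    simp only [← sq]
    nlinarith [sq_nonneg (u 0 - ∑ i, w i * u i.succ),
      mul_nonneg (by linarith : 0 ≤ 1 - ξ) (hcs u)]

end
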